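/- Let a_m = Π_{P | m} |P|/(|P|+1) over monic irreducible divisors P of m, and d_k the k-fold divisor function on monic polynomials of F_q[T]. Then as x → ∞, Σ_{m monic, deg m = x} d_k(m²) a_m ∼ C(k) q^x x^{k(k+1)/2 - 1} for some positive constant C(k) depending only on k and q. -/

import Mathlib

open Polynomial Filter Asymptotics
open scoped Classical

variable {Fq : Type} [Field Fq] [Fintype Fq]

/-- Norm of a polynomial: `|f| = q^(deg f)` for `f ≠ 0`, and `|0| = 0`. -/
noncomputable def pnorm (f : Polynomial Fq) : ℝ :=
  if f = 0 then 0 else (Fintype.card Fq : ℝ) ^ f.natDegree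

/-- Monic polynomials of degree `n`. -/
def monicDeg (Fq : Type) [Field Fq] (n : ℕ) : Set (Polynomial Fq) :=
  {f | f.Monic ∧ f.natDegree = n}

/-- `H_{2g+1}`: monic square-free polynomials of degree `2g+1`. -/
def Hset (Fq : Type) [Field Fq] (g : ℕ) : Set (Polynomial Fq) :=
  {D | D.Monic ∧ Squarefree D ∧ D.natDegree = 2 * g + 1}

/-- Quadratic residue symbol `(D/P)` for an irreducible `P`. -/
noncomputable def quadCharP (D P : Polynomial Fq) : ℤ :=
  if P ∣ D then 0 else if ∃ x : Polynomial Fq, P ∣ (x ^ 2 - D) then 1 else -1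

/-- Jacobi-type quadratic residue symbol `(D/n)`, extended multiplicatively over
irreducible factors of `n`. -/
noncomputable def jacobi (D n : Polynomial Fq) : ℤ :=
  ((UniqueFactorizationMonoid.factors n).map (quadCharP D)).prod

/-- The quadratic Dirichlet L-function `L(s, χ_D)` as a finite sum
`Σ_{n=0}^{deg D - 1} (Σ_{f monic, deg f = n} χ_D(f)) q^{-ns}`. -/
noncomputable def Lfun (D : Polynomial Fq) (s : ℂ) : ℂ :=
  ∑ n ∈ Finset.range D.natDegree,
    (∑ᶠ f ∈ monicDeg Fq n, (jacobi D f : ℂ)) * (Fintype.card Fq : ℂ) ^ (-(n : ℂ) * s)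

/-- The central value `L(1/2, χ_D)` as a real number. -/
noncomputable def LhalfR (D : Polynomial Fq) : ℝ :=
  ∑ n ∈ Finset.range D.natDegree,
    (∑ᶠ f ∈ monicDeg Fq n, (jacobi D f : ℝ)) * (Real.sqrt (Fintype.card Fq))⁻¹ ^ n

/-- `a_m = Π_{P | m} |P|/(|P|+1)` over monic irreducible divisors `P` of `m`. -/
noncomputable def am (m : Polynomial Fq) : ℝ :=
  ∏ᶠ (P : Polynomial Fq) (_ : P.Monic ∧ Irreducible P ∧ P ∣ m), pnorm P / (pnorm P + 1)

/-- `d_k(m)`: the number of ordered `k`-tuples of monic polynomials with product `m`. -/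
noncomputable def dfold (k : ℕ) (m : Polynomial Fq) : ℕ :=
  Nat.card {t : Fin k → Polynomial Fq // (∀ i, (t i).Monic) ∧ ∏ i, t i = m}

/-- Möbius function on `F_q[T]`. -/
noncomputable def moebiusP (f : Polynomial Fq) : ℤ :=
  if Squarefree f then (-1) ^ (UniqueFactorizationMonoid.factors f).card else 0

/-- The Dirichlet polynomial `A(D) = Σ_{n monic, deg n ≤ 4g/(15k)} χ_D(n)/√|n|`. -/
noncomputable def AD (k g : ℕ) (D : Polynomial Fq) : ℝ :=
  ∑ᶠ n ∈ {n : Polynomial Fq | n.Monic ∧ n.natDegree ≤ 4 * g / (15 * k)},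
    (jacobi D n : ℝ) / Real.sqrt (pnorm n)

section PowerSeriesNorm

open scoped ENNReal

/-- The `ℓ¹` norm of the coefficient sequence of a real power series. -/
noncomputable def l1norm (A : PowerSeries ℝ) : ℝ≥0∞ := ∑' n, ‖PowerSeries.coeff n A‖ₑ

/-- The sum of all coefficients of a power series, i.e. its value at `1`. -/
noncomputable def coeffSum (A : PowerSeries ℝ) : ℝ := ∑' n, PowerSeries.coeff n A

lemma l1norm_add_le (A B : PowerSeries ℝ) : l1norm (A + B) ≤ l1norm A + l1norm B := by
  rw [l1norm, l1norm, l1norm, ← ENNReal.tsum_add]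
  exact ENNReal.tsum_le_tsum fun n => by simpa using enorm_add_le _ _

lemma l1norm_neg (A : PowerSeries ℝ) : l1norm (-A) = l1norm A := by
  simp [l1norm]

lemma l1norm_sub_le (A B : PowerSeries ℝ) : l1norm (A - B) ≤ l1norm A + l1norm B := by
  simpa [sub_eq_add_neg, l1norm_neg] using l1norm_add_le A (-B)

lemma l1norm_mul_le (A B : PowerSeries ℝ) : l1norm (A * B) ≤ l1norm A * l1norm B := by
  calc l1norm (A * B)
      ≤ ∑' n, ∑ p ∈ Finset.HasAntidiagonal.antidiagonal n,
          ‖PowerSeries.coeff p.1 A‖ₑ * ‖PowerSeries.coeff p.2 B‖ₑ := by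
        refine ENNReal.tsum_le_tsum fun n => ?_
        rw [PowerSeries.coeff_mul]
        refine (enorm_sum_le _ _).trans (Finset.sum_le_sum fun p _ => ?_)
        rw [enorm_mul]
    _ = ∑' p : ℕ × ℕ, ‖PowerSeries.coeff p.1 A‖ₑ * ‖PowerSeries.coeff p.2 B‖ₑ := by
        rw [← Finset.HasAntidiagonal.sigmaAntidiagonalEquivProd.tsum_eq, ENNReal.tsum_sigma']
        refine tsum_congr fun n => ?_
        rw [tsum_fintype]
        exact (Finset.sum_coe_sort (Finset.HasAntidiagonal.antidiagonal n)
          (fun p => ‖PowerSeries.coeff p.1 A‖ₑ * ‖PowerSeries.coeff p.2 B‖ₑ)).symm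
    _ = l1norm A * l1norm B := by
        rw [ENNReal.tsum_prod', l1norm, l1norm, ← ENNReal.tsum_mul_right]
        exact tsum_congr fun n => by simp only [ENNReal.tsum_mul_left]

lemma l1norm_C (c : ℝ) : l1norm (PowerSeries.C c) = ‖c‖ₑ := by
  rw [l1norm, tsum_eq_single 0]
  · simp
  · intro n hn
    simp [PowerSeries.coeff_C, hn]

lemma l1norm_one : l1norm 1 = 1 := by
  simpa using l1norm_C 1

lemma l1norm_X : l1norm PowerSeries.X = 1 := by
  rw [l1norm, tsum_eq_single 1]
  · simp
  · intro n hn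
    simp [PowerSeries.coeff_X, hn]

lemma l1norm_pow_le (A : PowerSeries ℝ) (n : ℕ) : l1norm (A ^ n) ≤ l1norm A ^ n := by
  induction n with
  | zero => simp [l1norm_one]
  | succ n ih =>
    rw [pow_succ, pow_succ]
    exact (l1norm_mul_le _ _).trans (by gcongr)

lemma l1norm_prod_le {ι : Type*} (s : Finset ι) (A : ι → PowerSeries ℝ) :
    l1norm (∏ i ∈ s, A i) ≤ ∏ i ∈ s, l1norm (A i) := by
  induction s using Finset.induction_on with
  | empty => simp [l1norm_one]
  | insert a s ha ih =>
    rw [Finset.prod_insert ha, Finset.prod_insert ha]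
    exact (l1norm_mul_le _ _).trans (by gcongr)

lemma l1norm_prod_sub_one_add_one_le {ι : Type*} (s : Finset ι) (A : ι → PowerSeries ℝ) :
    l1norm (∏ i ∈ s, A i - 1) + 1 ≤ ∏ i ∈ s, (l1norm (A i - 1) + 1) := by
  induction s using Finset.induction_on with
  | empty => simp [l1norm]
  | insert a s ha ih =>
    rw [Finset.prod_insert ha, Finset.prod_insert ha]
    have h : A a * ∏ i ∈ s, A i - 1 =
        (A a - 1) * (∏ i ∈ s, A i - 1) + (A a - 1) + (∏ i ∈ s, A i - 1) := by ring
    calc l1norm (A a * ∏ i ∈ s, A i - 1) + 1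
        ≤ l1norm (A a - 1) * l1norm (∏ i ∈ s, A i - 1) + l1norm (A a - 1)
            + l1norm (∏ i ∈ s, A i - 1) + 1 := by
          rw [h]
          gcongr
          refine (l1norm_add_le _ _).trans ?_
          gcongr
          refine (l1norm_add_le _ _).trans ?_
          gcongr
          exact l1norm_mul_le _ _
      _ = (l1norm (A a - 1) + 1) * (l1norm (∏ i ∈ s, A i - 1) + 1) := by ring
      _ ≤ _ := by gcongr

lemma tsum_expand {M : Type*} [AddCommMonoid M] [TopologicalSpace M]
    (f : ℝ → M) (hf : f 0 = 0) {d : ℕ} (hd : d ≠ 0) (A : PowerSeries ℝ) :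
    ∑' n, f (PowerSeries.coeff n (PowerSeries.expand d hd A)) =
      ∑' n, f (PowerSeries.coeff n A) := by
  have hinj : Function.Injective (fun n : ℕ => d * n) := fun a b h =>
    Nat.eq_of_mul_eq_mul_left (Nat.pos_of_ne_zero hd) h
  rw [← hinj.tsum_eq]
  · exact tsum_congr fun n => by rw [PowerSeries.coeff_expand_mul]
  · intro n hn
    by_contra h
    refine hn ?_
    simp only
    rw [PowerSeries.coeff_expand_of_not_dvd, hf]
    rintro ⟨m, rfl⟩
    exact h ⟨m, rfl⟩

lemma l1norm_expand {d : ℕ} (hd : d ≠ 0) (A : PowerSeries ℝ) :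
    l1norm (PowerSeries.expand d hd A) = l1norm A :=
  tsum_expand (fun x : ℝ => ‖x‖ₑ) (by simp) hd A

lemma coeffSum_expand {d : ℕ} (hd : d ≠ 0) (A : PowerSeries ℝ) :
    coeffSum (PowerSeries.expand d hd A) = coeffSum A :=
  tsum_expand (fun x : ℝ => x) rfl hd A

lemma summable_norm_coeff {A : PowerSeries ℝ} (hA : l1norm A ≠ ⊤) :
    Summable fun n => ‖PowerSeries.coeff n A‖ := by
  have h := ENNReal.summable_toReal hA
  simpa using h

lemma coeffSum_mul {A B : PowerSeries ℝ} (hA : l1norm A ≠ ⊤) (hB : l1norm B ≠ ⊤) :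
    coeffSum (A * B) = coeffSum A * coeffSum B := by
  rw [coeffSum, coeffSum, coeffSum, tsum_mul_tsum_eq_tsum_sum_antidiagonal_of_summable_norm
    (summable_norm_coeff hA) (summable_norm_coeff hB)]
  simp_rw [PowerSeries.coeff_mul]

lemma coeffSum_add {A B : PowerSeries ℝ} (hA : l1norm A ≠ ⊤) (hB : l1norm B ≠ ⊤) :
    coeffSum (A + B) = coeffSum A + coeffSum B := by
  rw [coeffSum, coeffSum, coeffSum,
    ← (summable_norm_coeff hA).of_norm.tsum_add (summable_norm_coeff hB).of_norm]
  simp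

lemma coeffSum_C (c : ℝ) : coeffSum (PowerSeries.C c) = c := by
  rw [coeffSum, tsum_eq_single 0]
  · simp
  · intro n hn
    simp [PowerSeries.coeff_C, hn]

lemma coeffSum_one : coeffSum 1 = 1 := by
  simpa using coeffSum_C 1

lemma coeffSum_X : coeffSum PowerSeries.X = 1 := by
  rw [coeffSum, tsum_eq_single 1]
  · simp
  · intro n hn
    simp [PowerSeries.coeff_X, hn]

lemma l1norm_prod_ne_top {ι : Type*} {s : Finset ι} {A : ι → PowerSeries ℝ}
    (hA : ∀ i ∈ s, l1norm (A i) ≠ ⊤) : l1norm (∏ i ∈ s, A i) ≠ ⊤ :=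
  ((l1norm_prod_le s A).trans_lt
    (ENNReal.prod_lt_top fun i hi => (hA i hi).lt_top)).ne

lemma coeffSum_prod {ι : Type*} {s : Finset ι} {A : ι → PowerSeries ℝ}
    (hA : ∀ i ∈ s, l1norm (A i) ≠ ⊤) :
    coeffSum (∏ i ∈ s, A i) = ∏ i ∈ s, coeffSum (A i) := by
  induction s using Finset.induction_on with
  | empty => simp [coeffSum_one]
  | insert a s ha ih =>
    rw [Finset.prod_insert ha, Finset.prod_insert ha, coeffSum_mul, ih]
    · exact fun i hi => hA i (Finset.mem_insert_of_mem hi)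
    · exact hA a (Finset.mem_insert_self a s)
    · exact l1norm_prod_ne_top fun i hi => hA i (Finset.mem_insert_of_mem hi)

lemma coeffSum_pos_of_l1norm_sub_one_lt {A : PowerSeries ℝ} (hA : l1norm (A - 1) < 1) :
    0 < coeffSum A := by
  have htop : l1norm (A - 1) ≠ ⊤ := (hA.trans ENNReal.one_lt_top).ne
  have h1 : coeffSum A = coeffSum (A - 1) + 1 := by
    conv_lhs => rw [← sub_add_cancel A 1]
    rw [coeffSum_add htop (by simp [l1norm_one]), coeffSum_one]
  have h2 : ‖coeffSum (A - 1)‖ ≤ ∑' n, ‖PowerSeries.coeff n (A - 1)‖ :=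
    norm_tsum_le_tsum_norm (summable_norm_coeff htop)
  have h3 : ENNReal.ofReal (∑' n, ‖PowerSeries.coeff n (A - 1)‖) = l1norm (A - 1) := by
    rw [ENNReal.ofReal_tsum_of_nonneg (fun _ => norm_nonneg _) (summable_norm_coeff htop)]
    simp only [l1norm, ofReal_norm]
  rw [← h3, ENNReal.ofReal_lt_one] at hA
  have := (abs_lt.1 (h2.trans_lt hA)).1
  linarith

lemma l1norm_rescale_le {A : PowerSeries ℝ} {n : ℕ} (hA : ∀ j < n, PowerSeries.coeff j A = 0)
    {t : ℝ} (ht : 0 ≤ t) (ht2 : 2 * t ≤ 1) :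
    l1norm (PowerSeries.rescale t A) ≤
      ENNReal.ofReal ((2 * t) ^ n) * l1norm (PowerSeries.rescale (1 / 2 : ℝ) A) := by
  rw [l1norm, l1norm, ← ENNReal.tsum_mul_left]
  refine ENNReal.tsum_le_tsum fun j => ?_
  rcases lt_or_ge j n with hj | hj
  · simp [PowerSeries.coeff_rescale, hA j hj]
  · rw [PowerSeries.coeff_rescale, PowerSeries.coeff_rescale, ← ofReal_norm,
      ← ofReal_norm, ← ENNReal.ofReal_mul (by positivity)]
    refine ENNReal.ofReal_le_ofReal ?_
    rw [norm_mul, norm_mul, ← mul_assoc, Real.norm_of_nonneg (by positivity : 0 ≤ t ^ j),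
      Real.norm_of_nonneg (by positivity : (0 : ℝ) ≤ (1 / 2) ^ j)]
    gcongr
    calc t ^ j = (2 * t) ^ j * (1 / 2) ^ j := by rw [← mul_pow]; congr 1; ring
      _ ≤ (2 * t) ^ n * (1 / 2) ^ j := by
        gcongr ?_ * _
        exact pow_le_pow_of_le_one (by positivity) ht2 hj

lemma l1norm_le_of_forall_dvd {A : PowerSeries ℝ} {b : ℝ≥0∞}
    (h : ∀ n, ∃ B : PowerSeries ℝ, l1norm B ≤ b ∧ PowerSeries.X ^ n ∣ A - B) :
    l1norm A ≤ b := by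
  rw [l1norm, ENNReal.tsum_eq_iSup_nat]
  refine iSup_le fun n => ?_
  obtain ⟨B, hB, hAB⟩ := h n
  refine le_trans ?_ hB
  calc ∑ j ∈ Finset.range n, ‖PowerSeries.coeff j A‖ₑ
      = ∑ j ∈ Finset.range n, ‖PowerSeries.coeff j B‖ₑ := by
        refine Finset.sum_congr rfl fun j hj => ?_
        have := PowerSeries.X_pow_dvd_iff.1 hAB j (Finset.mem_range.1 hj)
        rw [map_sub, sub_eq_zero] at this
        rw [this]
    _ ≤ l1norm B := ENNReal.sum_le_tsum _

end PowerSeriesNorm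

section PowerSeriesAsymptotics

open scoped ENNReal Topology

lemma l1norm_ne_top_of_summable {A : PowerSeries ℝ}
    (hA : Summable fun n => ‖PowerSeries.coeff n A‖) : l1norm A ≠ ⊤ := by
  have h := hA.tsum_ofReal_ne_top
  simpa only [l1norm, ofReal_norm] using h

/-- A power series which is the limit of finite products of series that are summably close to `1`
and have positive values at `1` is absolutely convergent at `1` with positive value. -/
lemma l1norm_ne_top_and_coeffSum_pos {ι : Type*} [DecidableEq ι] {S : ℕ → Finset ι} (hS : Monotone S)
    {L : ι → PowerSeries ℝ} {H : PowerSeries ℝ} {b : ι → ℝ}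
    (hH : ∀ n, PowerSeries.X ^ n ∣ H - ∏ i ∈ S n, L i)
    (hL : ∀ i, PowerSeries.constantCoeff (L i) = 1)
    (hb : ∀ i, 0 ≤ b i) (hLb : ∀ i, l1norm (L i - 1) ≤ ENNReal.ofReal (b i))
    (hpos : ∀ i, 0 < coeffSum (L i)) {n : ℕ}
    (htail : ∀ m, n ≤ m → ∑ i ∈ S m \ S n, b i ≤ 1 / 2) :
    l1norm H ≠ ⊤ ∧ 0 < coeffSum H := by
  have hLtop : ∀ i, l1norm (L i) ≠ ⊤ := fun i => by
    have h := (l1norm_add_le (L i - 1) 1).trans <|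
      add_le_add (hLb i) l1norm_one.le
    rw [sub_add_cancel] at h
    exact (h.trans_lt (by simp)).ne
  set P := ∏ i ∈ S n, L i with hP
  have hPtop : l1norm P ≠ ⊤ := l1norm_prod_ne_top fun i _ => hLtop i
  have hPinv : P * P⁻¹ = 1 := by
    refine PowerSeries.mul_inv_cancel P ?_
    rw [hP, map_prod, Finset.prod_eq_one fun i _ => hL i]
    exact one_ne_zero
  set T := P⁻¹ * H with hT
  have hHT : H = P * T := by rw [hT, ← mul_assoc, hPinv, one_mul]
  have hT1 : l1norm (T - 1) ≤ ENNReal.ofReal (Real.exp (1 / 2) - 1) := by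
    refine l1norm_le_of_forall_dvd fun m => ⟨∏ i ∈ S (max m n) \ S n, L i - 1, ?_, ?_⟩
    · have h1 : ∏ i ∈ S (max m n) \ S n, (l1norm (L i - 1) + 1) ≤
          ENNReal.ofReal (Real.exp (1 / 2)) := by
        calc ∏ i ∈ S (max m n) \ S n, (l1norm (L i - 1) + 1)
            ≤ ∏ i ∈ S (max m n) \ S n, ENNReal.ofReal (Real.exp (b i)) := by
              refine Finset.prod_le_prod' fun i _ => ?_
              calc l1norm (L i - 1) + 1 ≤ ENNReal.ofReal (b i) + ENNReal.ofReal 1 := by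
                    rw [ENNReal.ofReal_one]; gcongr; exact hLb i
                _ = ENNReal.ofReal (b i + 1) := (ENNReal.ofReal_add (hb i) zero_le_one).symm
                _ ≤ _ := ENNReal.ofReal_le_ofReal (Real.add_one_le_exp _)
          _ = ENNReal.ofReal (Real.exp (∑ i ∈ S (max m n) \ S n, b i)) := by
              rw [Real.exp_sum, ENNReal.ofReal_prod_of_nonneg fun i _ => (Real.exp_pos _).le]
          _ ≤ _ := by
              refine ENNReal.ofReal_le_ofReal (Real.exp_le_exp.2 ?_)
              exact htail _ (le_max_right _ _)
      rw [ENNReal.ofReal_sub _ zero_le_one, ENNReal.ofReal_one]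
      exact ENNReal.le_sub_of_add_le_right ENNReal.one_ne_top
        ((l1norm_prod_sub_one_add_one_le _ _).trans h1)
    · have h2 : T - 1 - (∏ i ∈ S (max m n) \ S n, L i - 1) =
          P⁻¹ * (H - ∏ i ∈ S (max m n), L i) := by
        rw [← Finset.prod_sdiff (hS (le_max_right m n)), ← hP, hT]
        linear_combination (∏ i ∈ S (max m n) \ S n, L i) * hPinv
      rw [h2]
      exact Dvd.dvd.mul_left ((pow_dvd_pow _ (le_max_left m n)).trans (hH _)) _
  have hT2 : l1norm (T - 1) < 1 := by
    refine hT1.trans_lt ?_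
    rw [ENNReal.ofReal_lt_one]
    have h4 : Real.exp (1 / 2) ^ 2 < 2 ^ 2 := by
      rw [← Real.exp_nat_mul]
      norm_num
      linarith [Real.exp_one_lt_d9]
    linarith [lt_of_pow_lt_pow_left₀ 2 (by norm_num) h4]
  have hTtop : l1norm T ≠ ⊤ := by
    have h := l1norm_add_le (T - 1) 1
    rw [sub_add_cancel, l1norm_one] at h
    exact (h.trans_lt (ENNReal.add_lt_top.2 ⟨hT2.trans ENNReal.one_lt_top, by simp⟩)).ne
  rw [hHT]
  refine ⟨((l1norm_mul_le P T).trans_lt (ENNReal.mul_lt_top hPtop.lt_top hTtop.lt_top)).ne, ?_⟩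
  rw [coeffSum_mul hPtop hTtop, coeffSum_prod fun i _ => hLtop i]
  exact mul_pos (Finset.prod_pos fun i _ => hpos i) (coeffSum_pos_of_l1norm_sub_one_lt hT2)

lemma tendsto_choose_sub_div_pow (p j : ℕ) :
    Tendsto (fun x : ℕ => ((p + (x - j)).choose p : ℝ) / (x : ℝ) ^ p) atTop
      (𝓝 (1 / (p.factorial : ℝ))) := by
  have h1 := (isEquivalent_choose p).comp_tendsto
    (tendsto_atTop_mono (fun x => by omega : ∀ x : ℕ, x - j ≤ p + (x - j))
      (tendsto_sub_atTop_nat j))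
  have h2 : Tendsto (fun x : ℕ => ((p + (x - j) : ℕ) : ℝ) / (x : ℝ)) atTop (𝓝 1) := by
    have h3 : Tendsto (fun x : ℕ => 1 + ((p : ℝ) - j) / (x : ℝ)) atTop (𝓝 (1 + 0)) :=
      tendsto_const_nhds.add (tendsto_const_div_atTop_nhds_zero_nat _)
    rw [add_zero] at h3
    refine h3.congr' ?_
    filter_upwards [eventually_ge_atTop (j + 1)] with x hx
    have hx0 : (x : ℝ) ≠ 0 := by
      have : x ≠ 0 := by omega
      exact_mod_cast this
    push_cast [Nat.cast_sub (by omega : j ≤ x)]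
    field_simp
    ring
  have h4 := h1.div (IsEquivalent.refl (u := fun x : ℕ => (x : ℝ) ^ p))
  refine h4.symm.tendsto_nhds ?_
  have h5 := (h2.pow p).div_const (p.factorial : ℝ)
  rw [one_pow] at h5
  refine h5.congr fun x => ?_
  simp only [Function.comp, Pi.div_apply]
  rw [div_pow, div_right_comm]

lemma tendsto_coeff_mul_mk_one_pow_div {H : PowerSeries ℝ} (hH : l1norm H ≠ ⊤) (p : ℕ) :
    Tendsto (fun x : ℕ => PowerSeries.coeff x (H * PowerSeries.mk 1 ^ (p + 1)) / (x : ℝ) ^ p)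
      atTop (𝓝 (coeffSum H / p.factorial)) := by
  set f : ℕ → ℕ → ℝ := fun x j => if j ≤ x then
    PowerSeries.coeff j H * (((p + (x - j)).choose p : ℝ) / (x : ℝ) ^ p) else 0 with hf
  have hsum : ∀ x : ℕ, PowerSeries.coeff x (H * PowerSeries.mk 1 ^ (p + 1)) / (x : ℝ) ^ p =
      ∑' j, f x j := fun x => by
    rw [PowerSeries.mk_one_pow_eq_mk_choose_add, PowerSeries.coeff_mul,
      Finset.Nat.sum_antidiagonal_eq_sum_range_succ_mk, Finset.sum_div,
      tsum_eq_sum (s := Finset.range x.succ)]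
    · refine Finset.sum_congr rfl fun j hj => ?_
      have : j ≤ x := Nat.lt_succ_iff.1 (Finset.mem_range.1 hj)
      simp [hf, this, mul_div_assoc]
    · intro j hj
      have : ¬ j ≤ x := fun h => hj (Finset.mem_range.2 (Nat.lt_succ_of_le h))
      simp [hf, this]
  simp_rw [hsum]
  rw [coeffSum, div_eq_mul_one_div, ← tsum_mul_right]
  refine tendsto_tsum_of_dominated_convergence
    (bound := fun j => ‖PowerSeries.coeff j H‖ * ((p + 1 : ℝ) ^ p))
    ((summable_norm_coeff hH).mul_right _) (fun j => ?_) ?_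
  · refine ((tendsto_choose_sub_div_pow p j).const_mul (PowerSeries.coeff j H)).congr' ?_
    filter_upwards [eventually_ge_atTop j] with x hx
    simp [hf, hx]
  · filter_upwards [eventually_ge_atTop 1] with x hx j
    simp only [hf]
    split_ifs with hj
    · rw [norm_mul]
      gcongr
      have hx' : (1 : ℝ) ≤ x := by exact_mod_cast hx
      rw [Real.norm_of_nonneg (by positivity), div_le_iff₀ (by positivity), ← mul_pow]
      calc ((p + (x - j)).choose p : ℝ) ≤ ((p + (x - j) : ℕ) : ℝ) ^ p := by
            exact_mod_cast Nat.choose_le_pow _ _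
        _ ≤ ((p + 1 : ℝ) * x) ^ p := by
            gcongr
            push_cast [Nat.cast_sub hj]
            nlinarith [(Nat.cast_nonneg j : (0 : ℝ) ≤ j), (Nat.cast_nonneg p : (0 : ℝ) ≤ p)]
    · rw [norm_zero]
      positivity

end PowerSeriesAsymptotics

section LocalFactor

open scoped ENNReal

/-- The generating series `∑ⱼ d_{k+1}(P^{2j}) uʲ` of the divisor function at squares of powers of a
prime. -/
noncomputable def squareDivisorSeries (k : ℕ) : PowerSeries ℝ :=
  PowerSeries.mk fun j => ((2 * j + k).choose k : ℝ)

/-- The local factor `1 + a ∑_{j ≥ 1} d_{k+1}(P^{2j}) uʲ`. -/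
noncomputable def localSeries (k : ℕ) (a : ℝ) : PowerSeries ℝ :=
  PowerSeries.mk fun j => ((2 * j + k).choose k : ℝ) * if j = 0 then 1 else a

lemma localSeries_eq (k : ℕ) (a : ℝ) :
    localSeries k a = squareDivisorSeries k -
      PowerSeries.C (1 - a) * (squareDivisorSeries k - 1) := by
  ext j
  rw [map_sub, PowerSeries.coeff_C_mul, map_sub, localSeries, squareDivisorSeries,
    PowerSeries.coeff_mk, PowerSeries.coeff_mk, PowerSeries.coeff_one]
  split_ifs with h
  · simp [h]
  · ring

lemma l1norm_rescale_squareDivisorSeries_ne_top (k : ℕ) {t : ℝ} (ht : 0 ≤ t) (ht1 : t < 1) :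
    l1norm (PowerSeries.rescale t (squareDivisorSeries k)) ≠ ⊤ := by
  have hs : ‖Real.sqrt t‖ < 1 := by
    rw [Real.norm_of_nonneg (Real.sqrt_nonneg t)]
    simpa using Real.sqrt_lt_sqrt ht ht1
  have h := (summable_choose_mul_geometric_of_norm_lt_one k hs).norm.comp_injective
    (fun a b h => by simpa using h : Function.Injective fun n : ℕ => 2 * n)
  refine l1norm_ne_top_of_summable (h.congr fun j => ?_)
  simp only [Function.comp, squareDivisorSeries, PowerSeries.coeff_rescale, PowerSeries.coeff_mk]
  rw [pow_mul, Real.sq_sqrt ht, mul_comm]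

lemma l1norm_mul_ne_top {A B : PowerSeries ℝ} (hA : l1norm A ≠ ⊤) (hB : l1norm B ≠ ⊤) :
    l1norm (A * B) ≠ ⊤ :=
  ((l1norm_mul_le A B).trans_lt (ENNReal.mul_lt_top hA.lt_top hB.lt_top)).ne

lemma l1norm_sub_ne_top {A B : PowerSeries ℝ} (hA : l1norm A ≠ ⊤) (hB : l1norm B ≠ ⊤) :
    l1norm (A - B) ≠ ⊤ :=
  ((l1norm_sub_le A B).trans_lt (ENNReal.add_lt_top.2 ⟨hA.lt_top, hB.lt_top⟩)).ne

lemma l1norm_pow_ne_top {A : PowerSeries ℝ} (hA : l1norm A ≠ ⊤) (n : ℕ) :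
    l1norm (A ^ n) ≠ ⊤ :=
  ((l1norm_pow_le A n).trans_lt (ENNReal.pow_lt_top hA.lt_top)).ne

lemma l1norm_C_ne_top (c : ℝ) : l1norm (PowerSeries.C c) ≠ ⊤ := by
  rw [l1norm_C]
  exact enorm_ne_top

lemma rescale_C (t c : ℝ) : PowerSeries.rescale t (PowerSeries.C c) = PowerSeries.C c := by
  ext n
  rw [PowerSeries.coeff_rescale, PowerSeries.coeff_C]
  split_ifs with h <;> simp [h]

lemma rescale_one_sub_X (t : ℝ) : PowerSeries.rescale t (1 - PowerSeries.X) =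
    1 - PowerSeries.C t * PowerSeries.X := by
  simp [PowerSeries.rescale_X]

lemma l1norm_rescale_one_sub_X_pow_ne_top (t : ℝ) (n : ℕ) :
    l1norm (PowerSeries.rescale t ((1 - PowerSeries.X) ^ n)) ≠ ⊤ := by
  rw [map_pow, rescale_one_sub_X]
  refine l1norm_pow_ne_top (l1norm_sub_ne_top (by simp [l1norm_one]) ?_) n
  exact l1norm_mul_ne_top (l1norm_C_ne_top _) (by simp [l1norm_X])

lemma coeffSum_rescale_one_sub_X_pow (t : ℝ) (n : ℕ) :
    coeffSum (PowerSeries.rescale t ((1 - PowerSeries.X) ^ n)) = (1 - t) ^ n := by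
  have hX : l1norm (PowerSeries.C (-t) * PowerSeries.X) ≠ ⊤ :=
    l1norm_mul_ne_top (l1norm_C_ne_top _) (by simp [l1norm_X])
  have h1 : coeffSum (PowerSeries.rescale t (1 - PowerSeries.X)) = 1 - t := by
    rw [rescale_one_sub_X, sub_eq_add_neg, ← neg_mul, ← map_neg,
      coeffSum_add (by simp [l1norm_one]) hX, coeffSum_one,
      coeffSum_mul (l1norm_C_ne_top _) (by simp [l1norm_X]), coeffSum_C, coeffSum_X]
    ring
  induction n with
  | zero => simp [coeffSum_one]
  | succ n ih =>
    rw [pow_succ, map_mul, coeffSum_mul (l1norm_rescale_one_sub_X_pow_ne_top t n), ih, h1, pow_succ]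
    simpa using l1norm_rescale_one_sub_X_pow_ne_top t 1

lemma l1norm_rescale_localSeries_ne_top (k : ℕ) (a : ℝ) {t : ℝ} (ht : 0 ≤ t) (ht1 : t < 1) :
    l1norm (PowerSeries.rescale t (localSeries k a)) ≠ ⊤ := by
  have h := l1norm_rescale_squareDivisorSeries_ne_top k ht ht1
  rw [localSeries_eq, map_sub, map_mul, rescale_C, map_sub (PowerSeries.rescale t), map_one]
  exact l1norm_sub_ne_top h (l1norm_mul_ne_top (l1norm_C_ne_top _)
    (l1norm_sub_ne_top h (by simp [l1norm_one])))

lemma coeffSum_rescale_localFactor_pos (k N : ℕ) {a t : ℝ} (ha : 0 ≤ a) (ht : 0 ≤ t)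
    (ht1 : t < 1) :
    0 < coeffSum (PowerSeries.rescale t (localSeries k a * (1 - PowerSeries.X) ^ N)) := by
  have h := l1norm_rescale_localSeries_ne_top k a ht ht1
  rw [map_mul, coeffSum_mul h (l1norm_rescale_one_sub_X_pow_ne_top t N),
    coeffSum_rescale_one_sub_X_pow]
  refine mul_pos ?_ (pow_pos (by linarith) N)
  refine (summable_norm_coeff h).of_norm.tsum_pos (fun j => ?_) 0 ?_
  · rw [PowerSeries.coeff_rescale, localSeries, PowerSeries.coeff_mk]
    positivity
  · simp [localSeries]

/-- The bound for the deviation of the normalised local factors from `1`. -/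
lemma exists_l1norm_rescale_localFactor_sub_one_le (k : ℕ) :
    ∃ c : ℝ, 0 ≤ c ∧ ∀ a t : ℝ, 0 ≤ t → 2 * t ≤ 1 → 0 ≤ 1 - a → 1 - a ≤ t →
      l1norm (PowerSeries.rescale t
        (localSeries k a * (1 - PowerSeries.X) ^ ((k + 1) * (k + 2) / 2)) - 1) ≤
        ENNReal.ofReal (c * t ^ 2) := by
  set N := (k + 1) * (k + 2) / 2 with hN
  set A₁ : PowerSeries ℝ := squareDivisorSeries k * (1 - PowerSeries.X) ^ N - 1 with hA₁
  set A₂ : PowerSeries ℝ := (squareDivisorSeries k - 1) * (1 - PowerSeries.X) ^ N with hA₂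
  have hG := l1norm_rescale_squareDivisorSeries_ne_top k (t := 1 / 2) (by norm_num) (by norm_num)
  have hX := l1norm_rescale_one_sub_X_pow_ne_top (1 / 2) N
  have h1 : l1norm (PowerSeries.rescale (1 / 2 : ℝ) A₁) ≠ ⊤ := by
    rw [hA₁, map_sub, map_mul, map_one]
    exact l1norm_sub_ne_top (l1norm_mul_ne_top hG hX) (by simp [l1norm_one])
  have h2 : l1norm (PowerSeries.rescale (1 / 2 : ℝ) A₂) ≠ ⊤ := by
    rw [hA₂, map_mul, map_sub, map_one]
    exact l1norm_mul_ne_top (l1norm_sub_ne_top hG (by simp [l1norm_one])) hX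
  have hc0 : PowerSeries.constantCoeff (squareDivisorSeries k) = 1 := by
    simp [squareDivisorSeries, ← PowerSeries.coeff_zero_eq_constantCoeff_apply]
  have hc1 : PowerSeries.coeff 1 (squareDivisorSeries k) = N := by
    rw [squareDivisorSeries, PowerSeries.coeff_mk, mul_one, hN,
      ← Nat.choose_symm_of_eq_add (show 2 + k = 2 + k from rfl), Nat.choose_two_right]
    congr 2
    rw [mul_comm]
    congr 1
    all_goals omega
  have hX1 : PowerSeries.coeff 1 ((1 - PowerSeries.X : PowerSeries ℝ) ^ N) = -N := by
    clear_value N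
    clear hN hA₁ hA₂ h1 h2 hG hX hc1
    induction N with
    | zero => simp [PowerSeries.coeff_one]
    | succ n ih =>
      rw [pow_succ, PowerSeries.coeff_one_mul, ih]
      simp [PowerSeries.coeff_one]
      ring
  have hz1 : ∀ j < 2, PowerSeries.coeff j A₁ = 0 := by
    intro j hj
    interval_cases j
    · simp [hA₁, hc0]
    · rw [hA₁, map_sub, PowerSeries.coeff_one_mul, hc1, hX1]
      simp [hc0, PowerSeries.coeff_one]
  have hz2 : ∀ j < 1, PowerSeries.coeff j A₂ = 0 := by
    intro j hj
    interval_cases j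
    simp [hA₂, hc0]
  refine ⟨4 * (l1norm (PowerSeries.rescale (1 / 2 : ℝ) A₁)).toReal +
    2 * (l1norm (PowerSeries.rescale (1 / 2 : ℝ) A₂)).toReal, by positivity, ?_⟩
  intro a t ht ht2 ha0 hat
  have hdecomp : PowerSeries.rescale t (localSeries k a * (1 - PowerSeries.X) ^ N) - 1 =
      PowerSeries.rescale t A₁ - PowerSeries.C (1 - a) * PowerSeries.rescale t A₂ := by
    have : localSeries k a * (1 - PowerSeries.X) ^ N - 1 = A₁ - PowerSeries.C (1 - a) * A₂ := by
      rw [localSeries_eq, hA₁, hA₂]; ring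
    rw [← rescale_C t (1 - a), ← map_mul, ← map_sub, ← this, map_sub, map_one]
  rw [hdecomp]
  set x₁ := l1norm (PowerSeries.rescale (1 / 2 : ℝ) A₁)
  set x₂ := l1norm (PowerSeries.rescale (1 / 2 : ℝ) A₂)
  calc l1norm (PowerSeries.rescale t A₁ - PowerSeries.C (1 - a) * PowerSeries.rescale t A₂)
      ≤ l1norm (PowerSeries.rescale t A₁) +
          ‖1 - a‖ₑ * l1norm (PowerSeries.rescale t A₂) := by
        refine (l1norm_sub_le _ _).trans ?_
        gcongr
        exact (l1norm_mul_le _ _).trans (by rw [l1norm_C])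
    _ ≤ ENNReal.ofReal ((2 * t) ^ 2) * x₁ +
          ENNReal.ofReal t * (ENNReal.ofReal ((2 * t) ^ 1) * x₂) := by
        gcongr
        · exact l1norm_rescale_le hz1 ht ht2
        · rw [← ofReal_norm, Real.norm_of_nonneg ha0]
          exact ENNReal.ofReal_le_ofReal hat
        · exact l1norm_rescale_le hz2 ht ht2
    _ = _ := by
        rw [← ENNReal.ofReal_toReal h1, ← ENNReal.ofReal_toReal h2,
          ← ENNReal.ofReal_mul (by positivity), ← ENNReal.ofReal_mul (by positivity),
          ← ENNReal.ofReal_mul (by positivity), ← ENNReal.ofReal_add (by positivity)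
            (by positivity)]
        rw [ENNReal.toReal_ofReal (by positivity), ENNReal.toReal_ofReal (by positivity)]
        congr 1
        ring

end LocalFactor

section MonicPolynomials

open UniqueFactorizationMonoid

/-- Monic irreducible polynomials over `Fq`. -/
abbrev MonicIrred (Fq : Type) [Field Fq] : Type := {P : Polynomial Fq // P.Monic ∧ Irreducible P}

lemma nat_card_monicDeg (n : ℕ) : Nat.card (monicDeg Fq n) = Fintype.card Fq ^ n := by
  refine (Nat.card_congr ((monicEquivDegreeLT n).trans (degreeLTEquiv Fq n).toEquiv)).trans ?_
  simp

lemma finite_monicDeg (n : ℕ) : (monicDeg Fq n).Finite := by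
  refine Nat.finite_of_card_ne_zero ?_
  rw [nat_card_monicDeg]
  exact pow_ne_zero _ Fintype.card_ne_zero

lemma finite_monicIrred_natDegree_le (n : ℕ) :
    {P : MonicIrred Fq | P.1.natDegree ≤ n}.Finite := by
  refine Set.Finite.of_finite_image (f := Subtype.val) ?_ Subtype.val_injective.injOn
  refine ((Set.finite_Iic n).biUnion fun i _ => finite_monicDeg i).subset ?_
  rintro _ ⟨P, hP, rfl⟩
  exact Set.mem_biUnion (show P.1.natDegree ∈ Set.Iic n from hP) ⟨P.2.1, rfl⟩

/-- Monic irreducible polynomials of degree at most `n`. -/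
noncomputable def monicIrredLE (Fq : Type) [Field Fq] [Fintype Fq] (n : ℕ) :
    Finset (MonicIrred Fq) :=
  (finite_monicIrred_natDegree_le n).toFinset

lemma mem_monicIrredLE {n : ℕ} {P : MonicIrred Fq} :
    P ∈ monicIrredLE Fq n ↔ P.1.natDegree ≤ n := by
  simp [monicIrredLE]

lemma monicIrredLE_mono : Monotone (monicIrredLE Fq) := fun _ _ hmn _ hP =>
  mem_monicIrredLE.2 ((mem_monicIrredLE.1 hP).trans hmn)

omit [Fintype Fq] in
lemma factorization_monicIrred (P : MonicIrred Fq) :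
    factorization P.1 = Finsupp.single P.1 1 := by
  ext Q
  rw [factorization_eq_count, normalizedFactors_irreducible P.2.2, P.2.1.normalize_eq_self,
    Multiset.count_singleton, Finsupp.single_apply]
  simp [eq_comm]

omit [Fintype Fq] in
lemma factorization_prod_pow (s : Finset (MonicIrred Fq)) (e : MonicIrred Fq → ℕ)
    (Q : MonicIrred Fq) :
    factorization (∏ P ∈ s, P.1 ^ e P) Q.1 = if Q ∈ s then e Q else 0 := by
  induction s using Finset.induction_on with
  | empty => simp
  | insert a s ha ih =>
    rw [Finset.prod_insert ha, factorization_mul (pow_ne_zero _ a.2.1.ne_zero)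
      (Finset.prod_ne_zero_iff.2 fun P _ => pow_ne_zero _ P.2.1.ne_zero), Finsupp.add_apply, ih,
      factorization_pow, factorization_monicIrred]
    by_cases hQ : Q = a
    · subst hQ
      simp [ha]
    · have : a.1 ≠ Q.1 := fun h => hQ (Subtype.ext h.symm)
      simp [hQ, this]

omit [Fintype Fq] in
lemma monic_prod_pow (s : Finset (MonicIrred Fq)) (e : MonicIrred Fq → ℕ) :
    (∏ P ∈ s, P.1 ^ e P).Monic :=
  monic_prod_of_monic _ _ fun P _ => P.2.1.pow _

omit [Fintype Fq] in
lemma factorization_ne_zero_iff (P : MonicIrred Fq) {m : Polynomial Fq} (hm : m.Monic) :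
    factorization m P.1 ≠ 0 ↔ P.1 ∣ m := by
  rw [factorization_eq_count, Multiset.count_ne_zero, mem_normalizedFactors_iff' hm.ne_zero]
  exact ⟨fun h => h.2.2, fun h => ⟨P.2.2, P.2.1.normalize_eq_self, h⟩⟩

lemma prod_pow_factorization {m : Polynomial Fq} (hm : m.Monic) {n : ℕ} (hn : m.natDegree ≤ n) :
    ∏ P ∈ monicIrredLE Fq n, P.1 ^ factorization m P.1 = m := by
  have h1 : (normalizedFactors m).prod = m := by
    rw [prod_normalizedFactors_eq hm.ne_zero, hm.normalize_eq_self]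
  conv_rhs => rw [← h1]
  rw [Finset.prod_multiset_count_of_subset (normalizedFactors m)
    ((monicIrredLE Fq n).map (Function.Embedding.subtype _)), Finset.prod_map]
  · exact Finset.prod_congr rfl fun P _ => by rw [factorization_eq_count]; rfl
  · intro P hP
    rw [Multiset.mem_toFinset, mem_normalizedFactors_iff' hm.ne_zero] at hP
    have hPm : P.Monic := by
      rw [← hP.2.1]
      exact monic_normalize hP.1.ne_zero
    exact Finset.mem_map.2 ⟨⟨P, hPm, hP.1⟩,
      mem_monicIrredLE.2 ((natDegree_le_of_dvd hP.2.2 hm.ne_zero).trans hn), rfl⟩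

lemma sum_natDegree_mul_factorization {m : Polynomial Fq} (hm : m.Monic) {n : ℕ}
    (hn : m.natDegree ≤ n) :
    ∑ P ∈ monicIrredLE Fq n, P.1.natDegree * factorization m P.1 = m.natDegree := by
  conv_rhs => rw [← prod_pow_factorization hm hn]
  rw [natDegree_prod_of_monic _ _ fun P _ => P.2.1.pow _]
  exact Finset.sum_congr rfl fun P _ => by rw [natDegree_pow, mul_comm]

omit [Fintype Fq] in
lemma MonicIrred.natDegree_ne_zero (P : MonicIrred Fq) : P.1.natDegree ≠ 0 :=
  P.2.2.natDegree_pos.ne'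

/-- The Euler product for a multiplicative function on monic polynomials, truncated to irreducible
polynomials of degree at most `n`. -/
lemma coeff_prod_expand {g : Polynomial Fq → ℝ} {h : MonicIrred Fq → PowerSeries ℝ} {n x : ℕ}
    (hx : x ≤ n)
    (hg : ∀ m ∈ monicDeg Fq x, g m =
      ∏ P ∈ monicIrredLE Fq n, PowerSeries.coeff (factorization m P.1) (h P)) :
    PowerSeries.coeff x
        (∏ P ∈ monicIrredLE Fq n, PowerSeries.expand P.1.natDegree P.natDegree_ne_zero (h P)) =
      ∑ᶠ m ∈ monicDeg Fq x, g m := by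
  set S := monicIrredLE Fq n
  rw [finsum_mem_eq_finite_toFinset_sum _ (finite_monicDeg x), PowerSeries.coeff_prod]
  symm
  have happ : ∀ (m : Polynomial Fq) (P : MonicIrred Fq), P ∈ S →
      (Finsupp.onFinset S (fun P : MonicIrred Fq =>
        if P ∈ S then P.1.natDegree * factorization m P.1 else 0) fun P hP => by
          by_contra h; simp [h] at hP) P = P.1.natDegree * factorization m P.1 :=
    fun m P hP => by simp [hP]
  refine Finset.sum_of_injOn (fun m => Finsupp.onFinset S (fun P : MonicIrred Fq =>
      if P ∈ S then P.1.natDegree * factorization m P.1 else 0) fun P hP => by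
        by_contra h; simp [h] at hP) ?_ ?_ ?_ ?_
  · intro a ha b hb hab
    simp only [Set.Finite.coe_toFinset] at ha hb
    rw [← prod_pow_factorization ha.1 (ha.2.trans_le hx),
      ← prod_pow_factorization hb.1 (hb.2.trans_le hx)]
    refine Finset.prod_congr rfl fun P hP => ?_
    have := DFunLike.congr_fun hab P
    simp only at this
    rw [happ a P hP, happ b P hP] at this
    rw [Nat.eq_of_mul_eq_mul_left (Nat.pos_of_ne_zero P.natDegree_ne_zero) this]
  · intro m hm
    simp only [Set.Finite.coe_toFinset] at hm
    rw [Finset.mem_coe, Finset.mem_finsuppAntidiag]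
    refine ⟨?_, Finsupp.support_onFinset_subset⟩
    rw [Finset.sum_congr rfl (happ m), sum_natDegree_mul_factorization hm.1 (hm.2.trans_le hx),
      hm.2]
  · intro l hl hl'
    by_contra hne
    refine hl' ?_
    rw [Finset.mem_finsuppAntidiag] at hl
    have hdvd : ∀ P ∈ S, P.1.natDegree ∣ l P := fun P hP => by
      by_contra hd
      exact hne (Finset.prod_eq_zero hP (PowerSeries.coeff_expand_of_not_dvd _ _ _ hd))
    have hfac : ∀ P ∈ S, P.1.natDegree *
        factorization (∏ P ∈ S, P.1 ^ (l P / P.1.natDegree)) P.1 = l P := fun P hP => by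
      rw [factorization_prod_pow S (fun P => l P / P.1.natDegree) P, if_pos hP,
        Nat.mul_div_cancel' (hdvd P hP)]
    refine ⟨∏ P ∈ S, P.1 ^ (l P / P.1.natDegree), ?_, ?_⟩
    · simp only [Set.Finite.coe_toFinset]
      refine ⟨monic_prod_pow S _, ?_⟩
      rw [natDegree_prod_of_monic _ _ fun P _ => P.2.1.pow _, ← hl.1]
      exact Finset.sum_congr rfl fun P hP => by
        rw [natDegree_pow, Nat.div_mul_cancel (hdvd P hP)]
    · ext P
      by_cases hP : P ∈ S
      · rw [happ _ P hP, hfac P hP]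
      · have : l P = 0 := by
          by_contra h
          exact hP (hl.2 (Finsupp.mem_support_iff.2 h))
        simp [hP, this]
  · intro m hm
    rw [Set.Finite.mem_toFinset] at hm
    rw [hg m hm]
    refine Finset.prod_congr rfl fun P hP => ?_
    rw [happ m P hP, PowerSeries.coeff_expand_mul]

lemma nat_card_sum_eq (k n : ℕ) :
    Nat.card {s : Fin (k + 1) → ℕ // ∑ i, s i = n} = (n + k).choose k := by
  have h1 : Nat.card {s : Fin (k + 1) → ℕ // ∑ i, s i = n} =
      (Finset.piAntidiag (Finset.univ : Finset (Fin (k + 1))) n).card := by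
    rw [Nat.subtype_card]
    intro s
    simp
  rw [h1, ← Finset.map_sym_eq_piAntidiag, Finset.card_map, Finset.sym_univ, Finset.card_univ,
    Sym.card_sym_eq_choose, Fintype.card_fin, ← Nat.choose_symm_add]
  congr 1
  omega

lemma dfold_eq_prod_choose (k : ℕ) {m : Polynomial Fq} (hm : m.Monic) {n : ℕ}
    (hn : m.natDegree ≤ n) :
    dfold (k + 1) m = ∏ P ∈ monicIrredLE Fq n, (factorization m P.1 + k).choose k := by
  set S := monicIrredLE Fq n with hS
  have hfac : ∀ t : Fin (k + 1) → Polynomial Fq, (∀ i, (t i).Monic) → ∀ P : MonicIrred Fq,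
      ∑ i, factorization (t i) P.1 = factorization (∏ i, t i) P.1 := fun t ht P => by
    have : ∀ s : Finset (Fin (k + 1)),
        ∑ i ∈ s, factorization (t i) P.1 = factorization (∏ i ∈ s, t i) P.1 := fun s => by
      induction s using Finset.induction_on with
      | empty => simp
      | insert a s ha ih =>
        rw [Finset.sum_insert ha, Finset.prod_insert ha, factorization_mul (ht a).ne_zero
          (Finset.prod_ne_zero_iff.2 fun i _ => (ht i).ne_zero), Finsupp.add_apply, ih]
    exact this _
  let f : {t : Fin (k + 1) → Polynomial Fq // (∀ i, (t i).Monic) ∧ ∏ i, t i = m} →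
      ∀ P : S, {s : Fin (k + 1) → ℕ // ∑ i, s i = factorization m P.1.1} := fun t P =>
    ⟨fun i => factorization (t.1 i) P.1.1, by rw [hfac t.1 t.2.1, t.2.2]⟩
  have hf : Function.Bijective f := by
    constructor
    · intro t u htu
      ext1
      funext i
      have hle : ∀ t : {t : Fin (k + 1) → Polynomial Fq // (∀ i, (t i).Monic) ∧ ∏ i, t i = m},
          (t.1 i).natDegree ≤ n := fun t =>
        (natDegree_le_of_dvd ((Finset.dvd_prod_of_mem t.1 (Finset.mem_univ i)).trans t.2.2.dvd)
          hm.ne_zero).trans hn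
      rw [← prod_pow_factorization (t.2.1 i) (hle t), ← prod_pow_factorization (u.2.1 i) (hle u)]
      refine Finset.prod_congr rfl fun P hP => ?_
      have h := congrFun (congrArg Subtype.val (congrFun htu ⟨P, hP⟩)) i
      simp only [f] at h
      rw [h]
    · intro s
      let e : Fin (k + 1) → MonicIrred Fq → ℕ := fun i P => if h : P ∈ S then (s ⟨P, h⟩).1 i else 0
      refine ⟨⟨fun i => ∏ P ∈ S, P.1 ^ e i P, fun i => monic_prod_pow S _, ?_⟩, ?_⟩
      · rw [Finset.prod_comm]
        conv_rhs => rw [← prod_pow_factorization hm hn, ← hS]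
        refine Finset.prod_congr rfl fun P hP => ?_
        rw [Finset.prod_pow_eq_pow_sum, ← (s ⟨P, hP⟩).2]
        simp [e, hP]
      · funext P
        ext i
        simp only [f]
        rw [factorization_prod_pow]
        simp [e]
  rw [dfold, Nat.card_congr (Equiv.ofBijective f hf), Nat.card_pi]
  simp_rw [nat_card_sum_eq]
  exact Finset.prod_coe_sort S fun P => (factorization m P.1 + k).choose k

lemma am_eq_prod {m : Polynomial Fq} (hm : m.Monic) {n : ℕ} (hn : m.natDegree ≤ n) :
    am m = ∏ P ∈ monicIrredLE Fq n,
      if factorization m P.1 = 0 then 1 else pnorm P.1 / (pnorm P.1 + 1) := by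
  rw [am]
  simp_rw [finprod_eq_if]
  rw [finprod_eq_prod_of_mulSupport_subset
    (s := (monicIrredLE Fq n).map (Function.Embedding.subtype _)), Finset.prod_map]
  · refine Finset.prod_congr rfl fun P _ => ?_
    have h := factorization_ne_zero_iff P hm
    by_cases hP : P.1 ∣ m
    · rw [if_neg (h.2 hP), if_pos ⟨P.2.1, P.2.2, hP⟩]
      rfl
    · have h0 : factorization m P.1 = 0 := by simpa using h.not.2 hP
      rw [if_pos h0]
      exact if_neg fun h' => hP h'.2.2
  · intro P hP
    have hP' : P.Monic ∧ Irreducible P ∧ P ∣ m := by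
      by_contra h
      simp [h] at hP
    exact Finset.mem_coe.2 (Finset.mem_map.2 ⟨⟨P, hP'.1, hP'.2.1⟩,
      mem_monicIrredLE.2 ((natDegree_le_of_dvd hP'.2.2 hm.ne_zero).trans hn), rfl⟩)

lemma two_le_card (Fq : Type) [Field Fq] [Fintype Fq] : (2 : ℝ) ≤ (Fintype.card Fq : ℝ) := by
  have h : 1 < Fintype.card Fq := Fintype.one_lt_card
  exact_mod_cast h

lemma sum_sdiff_monicIrredLE_le (n m : ℕ) :
    ∑ P ∈ monicIrredLE Fq m \ monicIrredLE Fq n,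
      (((Fintype.card Fq : ℝ)⁻¹) ^ P.1.natDegree) ^ 2 ≤ (1 / 2) ^ n := by
  set q : ℝ := (Fintype.card Fq : ℝ)
  have hq2 : 2 ≤ q := two_le_card Fq
  have hfiber : ∀ j, (((monicIrredLE Fq m \ monicIrredLE Fq n).filter
      fun P => P.1.natDegree = j).card : ℝ) ≤ q ^ j := fun j => by
    have h1 : ((monicIrredLE Fq m \ monicIrredLE Fq n).filter
        fun P => P.1.natDegree = j).card ≤ (finite_monicDeg (Fq := Fq) j).toFinset.card := by
      refine Finset.card_le_card_of_injOn Subtype.val (fun P hP => ?_) Subtype.val_injective.injOn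
      simp only [Set.Finite.coe_toFinset]
      exact ⟨P.2.1, (Finset.mem_filter.1 hP).2⟩
    rw [← Nat.card_eq_card_finite_toFinset, nat_card_monicDeg] at h1
    change _ ≤ (Fintype.card Fq : ℝ) ^ j
    exact_mod_cast h1
  have hmaps : ∀ P ∈ monicIrredLE Fq m \ monicIrredLE Fq n, P.1.natDegree ∈ Finset.Ico (n + 1)
      (m + 1) := fun P hP => by
    rw [Finset.mem_sdiff, mem_monicIrredLE, mem_monicIrredLE] at hP
    rw [Finset.mem_Ico]
    omega
  rw [← Finset.sum_fiberwise_of_maps_to hmaps]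
  calc ∑ j ∈ Finset.Ico (n + 1) (m + 1), ∑ P ∈ (monicIrredLE Fq m \ monicIrredLE Fq n).filter
          (fun P => P.1.natDegree = j), (q⁻¹ ^ P.1.natDegree) ^ 2
      ≤ ∑ j ∈ Finset.Ico (n + 1) (m + 1), (1 / 2 : ℝ) ^ j := by
        refine Finset.sum_le_sum fun j _ => ?_
        rw [Finset.sum_congr rfl (g := fun _ => (q⁻¹ ^ j) ^ 2)
          fun P hP => by rw [(Finset.mem_filter.1 hP).2], Finset.sum_const, nsmul_eq_mul]
        calc _ ≤ q ^ j * (q⁻¹ ^ j) ^ 2 := by gcongr; exact hfiber j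
          _ = q⁻¹ ^ j := by
            rw [sq, ← mul_assoc, ← mul_pow, mul_inv_cancel₀ (by linarith), one_pow, one_mul]
          _ ≤ (1 / 2) ^ j := by
            rw [one_div]
            gcongr
    _ ≤ (1 / 2 : ℝ) ^ (n + 1) / (1 - 1 / 2) :=
        geom_sum_Ico_le_of_lt_one (by norm_num) (by norm_num)
    _ = (1 / 2) ^ n := by rw [pow_succ]; ring

end MonicPolynomials

section GeneratingSeries

open UniqueFactorizationMonoid PowerSeries

/-- The generating series of `q⁻ˣ ∑_{deg m = x} d_k(m²) a_m`. -/
noncomputable def dfoldSeries (Fq : Type) [Field Fq] [Fintype Fq] (k : ℕ) : PowerSeries ℝ :=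
  PowerSeries.mk fun x => ∑ᶠ m ∈ monicDeg Fq x,
    (dfold k (m ^ 2) : ℝ) * am m * (Fintype.card Fq : ℝ)⁻¹ ^ x

/-- The variable `u ↦ (u / q)ᵈ` attached to an irreducible polynomial of degree `d`. -/
noncomputable def primeSubst (P : MonicIrred Fq) : PowerSeries ℝ →+* PowerSeries ℝ :=
  (PowerSeries.expand (R := ℝ) P.1.natDegree P.natDegree_ne_zero).toRingHom.comp
    (PowerSeries.rescale ((Fintype.card Fq : ℝ)⁻¹ ^ P.1.natDegree))

lemma primeSubst_apply (P : MonicIrred Fq) (A : PowerSeries ℝ) :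
    primeSubst P A = PowerSeries.expand P.1.natDegree P.natDegree_ne_zero
      (PowerSeries.rescale ((Fintype.card Fq : ℝ)⁻¹ ^ P.1.natDegree) A) := rfl

lemma l1norm_primeSubst_sub_one (P : MonicIrred Fq) (A : PowerSeries ℝ) :
    l1norm (primeSubst P A - 1) =
      l1norm (PowerSeries.rescale ((Fintype.card Fq : ℝ)⁻¹ ^ P.1.natDegree) A - 1) := by
  rw [primeSubst_apply, ← l1norm_expand P.natDegree_ne_zero
    (PowerSeries.rescale ((Fintype.card Fq : ℝ)⁻¹ ^ P.1.natDegree) A - 1), map_sub, map_one]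

lemma coeff_prod_primeSubst {g : Polynomial Fq → ℝ} {h : MonicIrred Fq → PowerSeries ℝ} {n x : ℕ}
    (hx : x ≤ n)
    (hg : ∀ m ∈ monicDeg Fq x, g m =
      ∏ P ∈ monicIrredLE Fq n, PowerSeries.coeff (factorization m P.1) (h P)) :
    PowerSeries.coeff x (∏ P ∈ monicIrredLE Fq n, primeSubst P (h P)) =
      ∑ᶠ m ∈ monicDeg Fq x, g m * (Fintype.card Fq : ℝ)⁻¹ ^ x := by
  simp_rw [primeSubst_apply]
  rw [coeff_prod_expand (g := fun m => g m * (Fintype.card Fq : ℝ)⁻¹ ^ x) hx]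
  intro m hm
  simp_rw [PowerSeries.coeff_rescale]
  rw [Finset.prod_mul_distrib, ← hg m hm, mul_comm]
  simp_rw [← pow_mul]
  rw [Finset.prod_pow_eq_pow_sum, sum_natDegree_mul_factorization hm.1 (hm.2.trans_le hx), hm.2]

/-- The factor `|P| / (|P| + 1)`. -/
noncomputable def normRatio (P : MonicIrred Fq) : ℝ := pnorm P.1 / (pnorm P.1 + 1)

lemma X_pow_dvd_dfoldSeries_sub (k n : ℕ) :
    PowerSeries.X ^ n ∣ dfoldSeries Fq (k + 1) -
      ∏ P ∈ monicIrredLE Fq n, primeSubst P (localSeries k (normRatio P)) := by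
  rw [PowerSeries.X_pow_dvd_iff]
  intro x hx
  rw [map_sub, sub_eq_zero, dfoldSeries, PowerSeries.coeff_mk]
  symm
  refine coeff_prod_primeSubst (g := fun m => (dfold (k + 1) (m ^ 2) : ℝ) * am m) hx.le ?_
  intro m hm
  have hdeg : (m ^ 2).natDegree ≤ 2 * n := by
    rw [natDegree_pow, hm.2]
    omega
  have hzero : ∀ P ∈ monicIrredLE Fq (2 * n), P ∉ monicIrredLE Fq n →
      (factorization (m ^ 2) P.1 + k).choose k = 1 := fun P _ hP => by
    have h0 : factorization m P.1 = 0 := by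
      by_contra h
      refine hP (mem_monicIrredLE.2 ?_)
      have := natDegree_le_of_dvd ((factorization_ne_zero_iff P hm.1).1 h) hm.1.ne_zero
      rw [hm.2] at this
      omega
    simp [factorization_pow, h0]
  rw [dfold_eq_prod_choose k (hm.1.pow 2) hdeg, am_eq_prod hm.1 (hm.2.trans_le hx.le),
    ← Finset.prod_subset (monicIrredLE_mono (by omega : n ≤ 2 * n)) hzero, Nat.cast_prod,
    ← Finset.prod_mul_distrib]
  refine Finset.prod_congr rfl fun P _ => ?_
  simp [localSeries, factorization_pow, normRatio]

lemma X_pow_dvd_mk_one_sub (n : ℕ) :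
    PowerSeries.X ^ n ∣ PowerSeries.mk 1 -
      ∏ P ∈ monicIrredLE Fq n, primeSubst P (PowerSeries.mk 1) := by
  rw [PowerSeries.X_pow_dvd_iff]
  intro x hx
  rw [map_sub, sub_eq_zero, coeff_prod_primeSubst (g := fun _ => 1) hx.le (by simp),
    finsum_mem_eq_finite_toFinset_sum _ (finite_monicDeg x), Finset.sum_const,
    ← Nat.card_eq_card_finite_toFinset, nat_card_monicDeg]
  have : (Fintype.card Fq : ℝ) ≠ 0 := by simp
  simp [this]

lemma X_pow_dvd_one_sub_X_sub (n : ℕ) :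
    PowerSeries.X ^ n ∣ (1 - PowerSeries.X) -
      ∏ P ∈ monicIrredLE Fq n, primeSubst P (1 - PowerSeries.X) := by
  have hR : (∏ P ∈ monicIrredLE Fq n, primeSubst P (PowerSeries.mk 1)) *
      ∏ P ∈ monicIrredLE Fq n, primeSubst P (1 - PowerSeries.X) = 1 := by
    rw [← Finset.prod_mul_distrib]
    refine Finset.prod_eq_one fun P _ => ?_
    rw [← map_mul, PowerSeries.mk_one_mul_one_sub_eq_one, map_one]
  have hZ : (PowerSeries.mk 1 : PowerSeries ℝ) * (1 - PowerSeries.X) = 1 :=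
    PowerSeries.mk_one_mul_one_sub_eq_one ℝ
  set Q := ∏ P ∈ monicIrredLE Fq n, primeSubst P (PowerSeries.mk 1)
  set R := ∏ P ∈ monicIrredLE Fq n, primeSubst P (1 - PowerSeries.X)
  have h : (1 - PowerSeries.X) - R =
      (PowerSeries.mk 1 - Q) * (-((1 - PowerSeries.X) * R)) := by
    linear_combination (-(1 - PowerSeries.X)) * hR + R * hZ
  rw [h]
  exact (X_pow_dvd_mk_one_sub n).mul_right _

lemma X_pow_dvd_dfoldSeries_mul_sub (k N n : ℕ) :
    PowerSeries.X ^ n ∣ dfoldSeries Fq (k + 1) * (1 - PowerSeries.X) ^ N -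
      ∏ P ∈ monicIrredLE Fq n,
        primeSubst P (localSeries k (normRatio P) * (1 - PowerSeries.X) ^ N) := by
  simp_rw [map_mul, map_pow]
  rw [Finset.prod_mul_distrib, Finset.prod_pow]
  exact dvd_mul_sub_mul (X_pow_dvd_dfoldSeries_sub k n)
    ((X_pow_dvd_one_sub_X_sub n).trans (sub_dvd_pow_sub_pow _ _ N))

lemma normRatio_nonneg (P : MonicIrred Fq) : 0 ≤ normRatio P := by
  rw [normRatio, pnorm, if_neg P.2.1.ne_zero]
  positivity

lemma one_sub_normRatio (P : MonicIrred Fq) :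
    1 - normRatio P = ((Fintype.card Fq : ℝ) ^ P.1.natDegree + 1)⁻¹ := by
  rw [normRatio, pnorm, if_neg P.2.1.ne_zero]
  field_simp
  ring

lemma one_sub_normRatio_nonneg (P : MonicIrred Fq) : 0 ≤ 1 - normRatio P := by
  rw [one_sub_normRatio]
  positivity

lemma one_sub_normRatio_le (P : MonicIrred Fq) :
    1 - normRatio P ≤ (Fintype.card Fq : ℝ)⁻¹ ^ P.1.natDegree := by
  have := two_le_card Fq
  rw [one_sub_normRatio, inv_pow]
  gcongr
  linarith

lemma two_mul_inv_card_pow_le (P : MonicIrred Fq) :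
    2 * (Fintype.card Fq : ℝ)⁻¹ ^ P.1.natDegree ≤ 1 := by
  have h2 := two_le_card Fq
  have h : (Fintype.card Fq : ℝ)⁻¹ ^ P.1.natDegree ≤ (Fintype.card Fq : ℝ)⁻¹ ^ 1 :=
    pow_le_pow_of_le_one (by positivity) (inv_le_one_of_one_le₀ (by linarith))
      P.2.2.natDegree_pos
  rw [pow_one] at h
  have h3 : (Fintype.card Fq : ℝ)⁻¹ ≤ 2⁻¹ := by gcongr
  linarith

lemma l1norm_ne_top_and_coeffSum_dfoldSeries_pos (k : ℕ) :
    l1norm (dfoldSeries Fq (k + 1) * (1 - PowerSeries.X) ^ ((k + 1) * (k + 2) / 2)) ≠ ⊤ ∧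
      0 < coeffSum (dfoldSeries Fq (k + 1) *
        (1 - PowerSeries.X) ^ ((k + 1) * (k + 2) / 2)) := by
  obtain ⟨c, hc, hloc⟩ := exists_l1norm_rescale_localFactor_sub_one_le k
  obtain ⟨n, hn⟩ : ∃ n : ℕ, c * (1 / 2) ^ n ≤ 1 / 2 := by
    have h := (tendsto_pow_atTop_nhds_zero_of_lt_one (r := (1 / 2 : ℝ)) (by norm_num)
      (by norm_num)).const_mul c
    rw [mul_zero] at h
    exact (h.eventually_le_const (by norm_num : (0 : ℝ) < 1 / 2)).exists
  refine l1norm_ne_top_and_coeffSum_pos monicIrredLE_mono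
    (b := fun P => c * ((Fintype.card Fq : ℝ)⁻¹ ^ P.1.natDegree) ^ 2) (n := n)
    (X_pow_dvd_dfoldSeries_mul_sub k _) (fun P => ?_) (fun P => by positivity) (fun P => ?_)
    (fun P => ?_) (fun m _ => ?_)
  · rw [primeSubst_apply, PowerSeries.constantCoeff_expand,
      ← PowerSeries.coeff_zero_eq_constantCoeff_apply, PowerSeries.coeff_rescale]
    rw [pow_zero, one_mul, PowerSeries.coeff_zero_eq_constantCoeff_apply, map_mul, map_pow,
      map_sub, map_one, PowerSeries.constantCoeff_X, sub_zero, one_pow, mul_one,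
      ← PowerSeries.coeff_zero_eq_constantCoeff_apply, localSeries, PowerSeries.coeff_mk]
    simp
  · rw [l1norm_primeSubst_sub_one]
    exact hloc _ _ (by positivity) (two_mul_inv_card_pow_le P) (one_sub_normRatio_nonneg P)
      (one_sub_normRatio_le P)
  · rw [primeSubst_apply, coeffSum_expand]
    refine coeffSum_rescale_localFactor_pos k _ (normRatio_nonneg P) (by positivity) ?_
    have := two_mul_inv_card_pow_le P
    have h0 : 0 ≤ (Fintype.card Fq : ℝ)⁻¹ ^ P.1.natDegree := by positivity
    linarith
  · rw [← Finset.mul_sum]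
    exact (mul_le_mul_of_nonneg_left (sum_sdiff_monicIrredLE_le n m) hc).trans hn

end GeneratingSeries

/-- `Σ_{deg m = x} d_k(m²) a_m ∼ C(k) q^x x^{k(k+1)/2 - 1}` as `x → ∞`. -/
theorem dk_sum_asymptotic (k : ℕ) (hk : 0 < k) :
    ∃ C : ℝ, 0 < C ∧
      (fun x : ℕ => ∑ᶠ m ∈ monicDeg Fq x, (dfold k (m ^ 2) : ℝ) * am m)
        ~[atTop]
      (fun x : ℕ => C * (Fintype.card Fq : ℝ) ^ x * (x : ℝ) ^ (k * (k + 1) / 2 - 1)) := by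
  obtain ⟨k, rfl⟩ := Nat.exists_eq_succ_of_ne_zero hk.ne'
  rw [Nat.succ_eq_add_one, show k + 1 + 1 = k + 2 from rfl]
  obtain ⟨p, hp⟩ : ∃ p, (k + 1) * (k + 2) / 2 = p + 1 := by
    refine Nat.exists_eq_add_one.2 (Nat.div_pos ?_ two_pos)
    nlinarith
  obtain ⟨htop, hpos⟩ := l1norm_ne_top_and_coeffSum_dfoldSeries_pos (Fq := Fq) k
  rw [hp] at htop hpos ⊢
  set H := dfoldSeries Fq (k + 1) * (1 - PowerSeries.X) ^ (p + 1) with hH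
  have hF : H * PowerSeries.mk 1 ^ (p + 1) = dfoldSeries Fq (k + 1) := by
    rw [hH, mul_assoc, ← mul_pow, mul_comm (1 - PowerSeries.X : PowerSeries ℝ),
      PowerSeries.mk_one_mul_one_sub_eq_one, one_pow, mul_one]
  have hlim := tendsto_coeff_mul_mk_one_pow_div htop p
  rw [hF] at hlim
  have hC : 0 < coeffSum H / p.factorial := div_pos hpos (by positivity)
  refine ⟨coeffSum H / p.factorial, hC, ?_⟩
  have hq : (Fintype.card Fq : ℝ) ≠ 0 := by simp
  rw [Nat.add_sub_cancel]
  have hne : ∀ᶠ x : ℕ in atTop,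
      coeffSum H / p.factorial * (Fintype.card Fq : ℝ) ^ x * (x : ℝ) ^ p ≠ 0 := by
    filter_upwards [eventually_ne_atTop 0] with x hx
    have : (x : ℝ) ≠ 0 := by exact_mod_cast hx
    exact mul_ne_zero (mul_ne_zero hC.ne' (pow_ne_zero _ hq)) (pow_ne_zero _ this)
  rw [isEquivalent_iff_tendsto_one hne]
  have hlim' := hlim.div_const (coeffSum H / p.factorial)
  rw [div_self hC.ne'] at hlim'
  refine hlim'.congr fun x => ?_
  rw [Pi.div_apply, dfoldSeries, PowerSeries.coeff_mk, ← finsum_mem_mul' _ _ (finite_monicDeg x),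
    inv_pow]
  have := pow_ne_zero x hq
  field_simp
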